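/- There exists a constant C such that for every prime p and every pair of linearly independent vectors α, β ∈ 𝔽_p² ∖ {0}, the number of tuples A ∈ 𝒜_ord^short whose first two entries are α and β is at most C·n^{1.7}, where n = p² − 1. -/

import Mathlib

/-- Two vectors of `𝔽_p²` are collinear if one is a scalar multiple of the other. -/
def Coll (p : ℕ) (v w : Fin 2 → ZMod p) : Prop :=
  ∃ c : ZMod p, w = c • v ∨ v = c • w

/-- `gmat p a b` is the 2×2 matrix over `𝔽_p` whose columns are `a` and `b`. -/
def gmat (p : ℕ) (a b : Fin 2 → ZMod p) : Matrix (Fin 2) (Fin 2) (ZMod p) :=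
  Matrix.of fun i j => if j = 0 then a i else b i

/-- The set of off-diagonal index pairs `(i,j)`, `i ≠ j`, of `Fin 5`. -/
def offDiag5 : Finset (Fin 5 × Fin 5) :=
  Finset.univ.filter fun ij => ij.1 ≠ ij.2

/-- The set of index pairs `(i,j)` with `i < j` in `Fin 5`. -/
def underDiag5 : Finset (Fin 5 × Fin 5) :=
  Finset.univ.filter fun ij => ij.1 < ij.2

/-- `𝒜_ord`: the set of 5-tuples of pairwise non-collinear vectors of `𝔽_p² ∖ {0}`
summing to `0`. -/
def AOrd (p : ℕ) : Set (Fin 5 → Fin 2 → ZMod p) :=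
  {A | (∀ i, A i ≠ 0) ∧ (∑ i, A i) = 0 ∧ ∀ i j, i ≠ j → ¬ Coll p (A i) (A j)}

/-- A tuple of integers `(d_{ij})_{i≠j}` is a dependence if `∑_{i≠j} d_{ij} = 0`. -/
def IsDep (d : Fin 5 → Fin 5 → ℤ) : Prop :=
  ∑ ij ∈ offDiag5, d ij.1 ij.2 = 0

/-- Twice the length of a dependence: `∑_{i<j} |d_{ij} + d_{ji}|`. -/
def depLen2 (d : Fin 5 → Fin 5 → ℤ) : ℤ :=
  ∑ ij ∈ underDiag5, |d ij.1 ij.2 + d ij.2 ij.1|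

/-- The value `ω(A) = ∏_{i≠j} det(g_{ij}(A))^{d_{ij}}` of a dependence at a tuple `A`. -/
def omegaEval (p : ℕ) [Fact p.Prime] (d : Fin 5 → Fin 5 → ℤ)
    (A : Fin 5 → Fin 2 → ZMod p) : ZMod p :=
  ∏ ij ∈ offDiag5, (gmat p (A ij.1) (A ij.2)).det ^ (d ij.1 ij.2)

/-- A dependence is trivial if `ω(A) = 1` for all `A ∈ 𝒜_ord`. -/
def TrivialDep (p : ℕ) [Fact p.Prime] (d : Fin 5 → Fin 5 → ℤ) : Prop :=
  ∀ A ∈ AOrd p, omegaEval p d A = 1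

/-- `𝒜_ord^short`: tuples `A ∈ 𝒜_ord` satisfying a nontrivial dependence of length at most
`t = n^{0.01}` (with `n = p² - 1`). -/
def AOrdShort (p : ℕ) [Fact p.Prime] : Set (Fin 5 → Fin 2 → ZMod p) :=
  {A ∈ AOrd p | ∃ d : Fin 5 → Fin 5 → ℤ, IsDep d ∧
    (depLen2 d : ℝ) ≤ 2 * ((p ^ 2 - 1 : ℕ) : ℝ) ^ (0.01 : ℝ) ∧
    ¬ TrivialDep p d ∧ omegaEval p d A = 1}



section Determinants

variable {p : ℕ}

theorem det_gmat (a b : Fin 2 → ZMod p) : (gmat p a b).det = a 0 * b 1 - b 0 * a 1 := by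
  simp [gmat, Matrix.det_fin_two]

theorem det_gmat_swap (a b : Fin 2 → ZMod p) : (gmat p b a).det = -(gmat p a b).det := by
  simp only [det_gmat]; ring

theorem gmat_mulVec (g : Matrix (Fin 2) (Fin 2) (ZMod p)) (a b : Fin 2 → ZMod p) :
    gmat p (g.mulVec a) (g.mulVec b) = g * gmat p a b := by
  ext i j
  fin_cases j <;> simp [gmat, Matrix.mul_apply, Matrix.mulVec, dotProduct]

theorem gmat_mulVec_zero (a b : Fin 2 → ZMod p) :
    (gmat p a b).mulVec ![1, 0] = a := by
  ext i
  simp [gmat, Matrix.mulVec, dotProduct]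

theorem gmat_mulVec_one (a b : Fin 2 → ZMod p) :
    (gmat p a b).mulVec ![0, 1] = b := by
  ext i
  simp [gmat, Matrix.mulVec, dotProduct]

variable [Fact p.Prime]

theorem coll_of_det_gmat_eq_zero {a b : Fin 2 → ZMod p} (ha : a ≠ 0)
    (h : (gmat p a b).det = 0) : Coll p a b := by
  rw [det_gmat] at h
  by_cases h0 : a 0 = 0
  · have h1 : a 1 ≠ 0 := fun h1 => ha (by ext i; fin_cases i <;> simp [h0, h1])
    have hb : b 0 = 0 := by simpa [h0, h1] using h
    refine ⟨b 1 / a 1, Or.inl ?_⟩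
    ext i
    fin_cases i
    · simp [h0, hb]
    · simp [h1]
  · refine ⟨b 0 / a 0, Or.inl ?_⟩
    ext i
    fin_cases i
    · simp [h0]
    · simp only [Fin.mk_one, Pi.smul_apply, smul_eq_mul]
      field_simp
      linear_combination h

theorem det_gmat_ne_zero_of_linearIndependent {a b : Fin 2 → ZMod p} (ha : a ≠ 0)
    (h : LinearIndependent (ZMod p) ![a, b]) : (gmat p a b).det ≠ 0 := by
  intro hd
  rw [det_gmat] at hd
  rw [LinearIndependent.pair_iff] at h
  obtain ⟨-, h0⟩ := h (b 0) (-a 0) (by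
    ext i
    fin_cases i
    · simp; ring
    · simp; linear_combination -hd)
  obtain ⟨-, h1⟩ := h (b 1) (-a 1) (by
    ext i
    fin_cases i
    · simp; linear_combination hd
    · simp; ring)
  refine ha ?_
  ext i
  fin_cases i
  · simpa using h0
  · simpa using h1

theorem AOrd.det_gmat_ne_zero {A : Fin 5 → Fin 2 → ZMod p} (hA : A ∈ AOrd p) {i j : Fin 5}
    (hij : i ≠ j) : (gmat p (A i) (A j)).det ≠ 0 :=
  fun h => hA.2.2 i j hij (coll_of_det_gmat_eq_zero (hA.1 i) h)

end Determinants

section Invariance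

variable {p : ℕ} [Fact p.Prime]

theorem AOrd.mulVec_mem {A : Fin 5 → Fin 2 → ZMod p} (hA : A ∈ AOrd p)
    {g : Matrix (Fin 2) (Fin 2) (ZMod p)} (hg : g.det ≠ 0) :
    (fun i => g.mulVec (A i)) ∈ AOrd p := by
  have hinj : Function.Injective g.mulVec :=
    Matrix.mulVec_injective_of_isUnit ((Matrix.isUnit_iff_isUnit_det g).2 hg.isUnit)
  refine ⟨fun i h => hA.1 i (hinj (by simpa using h)), ?_, ?_⟩
  · rw [← Matrix.mulVec_sum, hA.2.1, Matrix.mulVec_zero]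
  · rintro i j hij ⟨c, h | h⟩
    · exact hA.2.2 i j hij ⟨c, Or.inl (hinj (by simpa [Matrix.mulVec_smul] using h))⟩
    · exact hA.2.2 i j hij ⟨c, Or.inr (hinj (by simpa [Matrix.mulVec_smul] using h))⟩

theorem omegaEval_mulVec {d : Fin 5 → Fin 5 → ℤ} (hd : IsDep d)
    (A : Fin 5 → Fin 2 → ZMod p) {g : Matrix (Fin 2) (Fin 2) (ZMod p)} (hg : g.det ≠ 0) :
    omegaEval p d (fun i => g.mulVec (A i)) = omegaEval p d A := by
  have hprod : ∀ s : Finset (Fin 5 × Fin 5),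
      ∏ ij ∈ s, g.det ^ (d ij.1 ij.2) = g.det ^ ∑ ij ∈ s, d ij.1 ij.2 := by
    intro s
    induction s using Finset.induction_on with
    | empty => simp
    | insert a s ha ih => rw [Finset.prod_insert ha, Finset.sum_insert ha, ih, zpow_add₀ hg]
  simp only [omegaEval, gmat_mulVec, Matrix.det_mul, mul_zpow, Finset.prod_mul_distrib]
  rw [hprod, show ∑ ij ∈ offDiag5, d ij.1 ij.2 = 0 from hd, zpow_zero, one_mul]

/-- A nontrivial dependence is already nontrivial on the tuples with prescribed linearly
independent first two entries. -/
theorem exists_omegaEval_ne_one {d : Fin 5 → Fin 5 → ℤ} (hd : IsDep d)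
    (hnt : ¬ TrivialDep p d) {a b : Fin 2 → ZMod p} (hab : (gmat p a b).det ≠ 0) :
    ∃ A ∈ AOrd p, A 0 = a ∧ A 1 = b ∧ omegaEval p d A ≠ 1 := by
  simp only [TrivialDep, not_forall] at hnt
  obtain ⟨B, hB, hne⟩ := hnt
  have hB0 : (gmat p (B 0) (B 1)).det ≠ 0 := AOrd.det_gmat_ne_zero hB (by decide)
  set h := gmat p (B 0) (B 1) with hh
  have hinv : h⁻¹ * h = 1 := Matrix.nonsing_inv_mul _ hB0.isUnit
  have hdet : (gmat p a b * h⁻¹).det ≠ 0 := by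
    rw [Matrix.det_mul]
    refine mul_ne_zero hab fun h0 => ?_
    have := congrArg Matrix.det hinv
    rw [Matrix.det_mul, h0] at this
    simp at this
  refine ⟨fun i => (gmat p a b * h⁻¹).mulVec (B i), AOrd.mulVec_mem hB hdet, ?_, ?_, ?_⟩
  · change (gmat p a b * h⁻¹).mulVec (B 0) = a
    rw [← gmat_mulVec_zero (B 0) (B 1), ← hh, Matrix.mulVec_mulVec, mul_assoc, hinv, mul_one,
      gmat_mulVec_zero]
  · change (gmat p a b * h⁻¹).mulVec (B 1) = b
    rw [← gmat_mulVec_one (B 0) (B 1), ← hh, Matrix.mulVec_mulVec, mul_assoc, hinv, mul_one,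
      gmat_mulVec_one]
  · rwa [omegaEval_mulVec hd B hdet]

/-- Product over unordered pairs of powers of the determinants. -/
def pairEval (p : ℕ) [Fact p.Prime] (e : Fin 5 × Fin 5 → ℤ) (A : Fin 5 → Fin 2 → ZMod p) :
    ZMod p :=
  ∏ ij ∈ underDiag5, (gmat p (A ij.1) (A ij.2)).det ^ e ij

/-- The exponents of the unordered pairs. -/
def pairExp (d : Fin 5 → Fin 5 → ℤ) (ij : Fin 5 × Fin 5) : ℤ :=
  if ij ∈ underDiag5 then d ij.1 ij.2 + d ij.2 ij.1 else 0

theorem prod_offDiag5 {M : Type*} [CommMonoid M] (f : Fin 5 × Fin 5 → M) :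
    ∏ ij ∈ offDiag5, f ij = ∏ ij ∈ underDiag5, (f ij * f ij.swap) := by
  rw [Finset.prod_mul_distrib]
  have h : offDiag5 = underDiag5 ∪ underDiag5.image Prod.swap := by decide
  rw [h, Finset.prod_union (by decide), Finset.prod_image Prod.swap_injective.injOn]

theorem exists_omegaEval_eq_mul_pairEval (d : Fin 5 → Fin 5 → ℤ) :
    ∃ s ∈ ({1, -1} : Finset (ZMod p)), ∀ A ∈ AOrd p,
      omegaEval p d A = s * pairEval p (pairExp d) A := by
  refine ⟨∏ ij ∈ underDiag5, (-1 : ZMod p) ^ d ij.2 ij.1, ?_, ?_⟩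
  · have hsq : (∏ ij ∈ underDiag5, (-1 : ZMod p) ^ d ij.2 ij.1) ^ 2 = 1 := by
      rw [← Finset.prod_pow]
      refine Finset.prod_eq_one fun ij _ => ?_
      rw [← zpow_natCast, ← zpow_mul, mul_comm, zpow_mul]
      simp
    simpa using hsq
  · intro A hA
    rw [omegaEval, prod_offDiag5, pairEval, ← Finset.prod_mul_distrib]
    refine Finset.prod_congr rfl fun ij hij => ?_
    have hne : ij.1 ≠ ij.2 := ne_of_lt (by simpa [underDiag5] using hij)
    have hD := AOrd.det_gmat_ne_zero hA hne
    simp only [pairExp, if_pos hij, Prod.fst_swap, Prod.snd_swap]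
    rw [det_gmat_swap (A ij.1) (A ij.2), neg_eq_neg_one_mul, mul_zpow, zpow_add₀ hD]
    ring

end Invariance

section Counting

open MvPolynomial

variable {p : ℕ}

/-- The generic tuple with sum zero and first two entries `a`, `b`. -/
noncomputable def genericTuple (a b : Fin 2 → ZMod p) :
    Fin 5 → Fin 2 → MvPolynomial (Fin 4) (ZMod p) :=
  ![fun k => C (a k), fun k => C (b k), ![X 0, X 1], ![X 2, X 3],
    fun k => -(C (a k) + C (b k) + ![X 0, X 1] k + ![X 2, X 3] k)]

/-- The coordinates of the third and fourth entries of a tuple. -/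
def middleCoords (A : Fin 5 → Fin 2 → ZMod p) : Fin 4 → ZMod p :=
  ![A 2 0, A 2 1, A 3 0, A 3 1]

theorem eval_genericTuple {A : Fin 5 → Fin 2 → ZMod p} (hA : ∑ i, A i = 0) (i : Fin 5)
    (k : Fin 2) : eval (middleCoords A) (genericTuple (A 0) (A 1) i k) = A i k := by
  have hk : A 0 k + A 1 k + A 2 k + A 3 k + A 4 k = 0 := by
    simpa [Fin.sum_univ_five] using congrFun hA k
  fin_cases i
  · simp [genericTuple]
  · simp [genericTuple]
  · fin_cases k <;> simp [genericTuple, middleCoords]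
  · fin_cases k <;> simp [genericTuple, middleCoords]
  · fin_cases k <;> simp [genericTuple, middleCoords] at hk ⊢ <;> linear_combination -hk

theorem eq_of_middleCoords_eq {A B : Fin 5 → Fin 2 → ZMod p} (hA : ∑ i, A i = 0)
    (hB : ∑ i, B i = 0) (h0 : A 0 = B 0) (h1 : A 1 = B 1)
    (h : middleCoords A = middleCoords B) : A = B := by
  ext i k
  rw [← eval_genericTuple hA, ← eval_genericTuple hB, h0, h1, h]

variable [Fact p.Prime]

theorem totalDegree_genericTuple_le (a b : Fin 2 → ZMod p) (i : Fin 5) (k : Fin 2) :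
    (genericTuple a b i k).totalDegree ≤ 1 := by
  have hX : ∀ i : Fin 4, (X i : MvPolynomial (Fin 4) (ZMod p)).totalDegree ≤ 1 :=
    fun i => (totalDegree_X i).le
  have hC : ∀ c : ZMod p, (C c : MvPolynomial (Fin 4) (ZMod p)).totalDegree ≤ 1 :=
    fun c => by simp
  have h2 : (![X 0, X 1] k : MvPolynomial (Fin 4) (ZMod p)).totalDegree ≤ 1 := by
    fin_cases k <;> exact hX _
  have h3 : (![X 2, X 3] k : MvPolynomial (Fin 4) (ZMod p)).totalDegree ≤ 1 := by
    fin_cases k <;> exact hX _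
  fin_cases i
  · exact hC _
  · exact hC _
  · exact h2
  · exact h3
  · change (-(C (a k) + C (b k) + (![X 0, X 1] : Fin 2 → MvPolynomial (Fin 4) (ZMod p)) k +
      (![X 2, X 3] : Fin 2 → MvPolynomial (Fin 4) (ZMod p)) k)).totalDegree ≤ 1
    rw [totalDegree_neg]
    refine (totalDegree_add _ _).trans (max_le ((totalDegree_add _ _).trans
      (max_le ((totalDegree_add _ _).trans (max_le (hC _) (hC _))) h2)) h3)

/-- The determinant of a pair of entries of the generic tuple. -/
noncomputable def genericDet (a b : Fin 2 → ZMod p) (ij : Fin 5 × Fin 5) :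
    MvPolynomial (Fin 4) (ZMod p) :=
  genericTuple a b ij.1 0 * genericTuple a b ij.2 1 -
    genericTuple a b ij.2 0 * genericTuple a b ij.1 1

theorem totalDegree_genericDet_le (a b : Fin 2 → ZMod p) (ij : Fin 5 × Fin 5) :
    (genericDet a b ij).totalDegree ≤ 2 := by
  have h : ∀ i j k l, (genericTuple a b i k * genericTuple a b j l).totalDegree ≤ 2 :=
    fun i j k l => (totalDegree_mul _ _).trans
      (add_le_add (totalDegree_genericTuple_le a b i k) (totalDegree_genericTuple_le a b j l))
  exact (totalDegree_sub _ _).trans (max_le (h _ _ _ _) (h _ _ _ _))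

theorem eval_genericDet {A : Fin 5 → Fin 2 → ZMod p} (hA : ∑ i, A i = 0)
    (ij : Fin 5 × Fin 5) :
    eval (middleCoords A) (genericDet (A 0) (A 1) ij) = (gmat p (A ij.1) (A ij.2)).det := by
  simp only [genericDet, map_sub, map_mul, eval_genericTuple hA, det_gmat]

/-- A polynomial whose zeros are the tuples with `s * pairEval p e A = 1`. -/
noncomputable def pairPoly (a b : Fin 2 → ZMod p) (e : Fin 5 × Fin 5 → ℤ) (s : ZMod p) :
    MvPolynomial (Fin 4) (ZMod p) :=
  C s * ∏ ij ∈ underDiag5, genericDet a b ij ^ (e ij).toNat -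
    ∏ ij ∈ underDiag5, genericDet a b ij ^ (-e ij).toNat

theorem totalDegree_pairPoly_le (a b : Fin 2 → ZMod p) (e : Fin 5 × Fin 5 → ℤ) (s : ZMod p) :
    (pairPoly a b e s).totalDegree ≤ 2 * ∑ ij ∈ underDiag5, (e ij).natAbs := by
  have h : ∀ f : Fin 5 × Fin 5 → ℕ, (∀ ij, f ij ≤ (e ij).natAbs) →
      (∏ ij ∈ underDiag5, genericDet a b ij ^ f ij).totalDegree ≤
        2 * ∑ ij ∈ underDiag5, (e ij).natAbs := by
    intro f hf
    refine (totalDegree_finsetProd _ _).trans ?_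
    rw [Finset.mul_sum]
    refine Finset.sum_le_sum fun ij _ => (totalDegree_pow _ _).trans ?_
    rw [mul_comm 2]
    exact Nat.mul_le_mul (hf ij) (totalDegree_genericDet_le a b ij)
  refine (totalDegree_sub _ _).trans (max_le ((totalDegree_mul _ _).trans ?_) ?_)
  · rw [totalDegree_C, zero_add]
    exact h _ fun ij => by omega
  · exact h _ fun ij => by omega

theorem eval_pairPoly_eq_zero_iff {A : Fin 5 → Fin 2 → ZMod p} (hA : A ∈ AOrd p)
    (e : Fin 5 × Fin 5 → ℤ) (s : ZMod p) :
    eval (middleCoords A) (pairPoly (A 0) (A 1) e s) = 0 ↔ s * pairEval p e A = 1 := by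
  have hne : ∀ ij ∈ underDiag5, (gmat p (A ij.1) (A ij.2)).det ≠ 0 := fun ij hij =>
    AOrd.det_gmat_ne_zero hA (ne_of_lt (by simpa [underDiag5] using hij))
  have hneg : ∏ ij ∈ underDiag5, (gmat p (A ij.1) (A ij.2)).det ^ (-e ij).toNat ≠ 0 :=
    Finset.prod_ne_zero_iff.2 fun ij hij => pow_ne_zero _ (hne ij hij)
  have hpos : ∏ ij ∈ underDiag5, (gmat p (A ij.1) (A ij.2)).det ^ (e ij).toNat =
      pairEval p e A * ∏ ij ∈ underDiag5, (gmat p (A ij.1) (A ij.2)).det ^ (-e ij).toNat := by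
    rw [pairEval, ← Finset.prod_mul_distrib]
    refine Finset.prod_congr rfl fun ij hij => ?_
    rw [← zpow_natCast, ← zpow_natCast, ← zpow_add₀ (hne ij hij)]
    congr 1
    omega
  simp only [pairPoly, map_sub, map_mul, map_prod, map_pow, eval_C, eval_genericDet hA.2.1]
  rw [hpos, sub_eq_zero, ← mul_assoc]
  exact mul_eq_right₀ hneg

theorem card_zeros_le {F : MvPolynomial (Fin 4) (ZMod p)} (hF : F ≠ 0) :
    (Finset.univ.filter fun x : Fin 4 → ZMod p => eval x F = 0).card ≤ F.totalDegree * p ^ 3 := by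
  have h := schwartz_zippel_totalDegree hF (Finset.univ : Finset (ZMod p))
  have hp : (0 : ℚ≥0) < p := by exact_mod_cast (Fact.out : p.Prime).pos
  simp only [Fintype.piFinset_univ, Finset.card_univ, ZMod.card] at h
  rw [div_le_div_iff₀ (by positivity) hp] at h
  have h' : ((Finset.univ.filter fun x : Fin 4 → ZMod p => eval x F = 0).card : ℚ≥0) * p ≤
      (F.totalDegree * p ^ 3 : ℕ) * p := h.trans_eq (by push_cast; ring)
  exact_mod_cast le_of_mul_le_mul_right h' hp

/-- The tuples with first entries `a`, `b` satisfying a given signed relation. -/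
def relationSet (p : ℕ) [Fact p.Prime] (a b : Fin 2 → ZMod p) (e : Fin 5 × Fin 5 → ℤ)
    (s : ZMod p) : Set (Fin 5 → Fin 2 → ZMod p) :=
  {A ∈ AOrd p | A 0 = a ∧ A 1 = b ∧ s * pairEval p e A = 1}

theorem ncard_relationSet_le {a b : Fin 2 → ZMod p} {e : Fin 5 × Fin 5 → ℤ} {s : ZMod p}
    (h : ∃ A ∈ AOrd p, A 0 = a ∧ A 1 = b ∧ s * pairEval p e A ≠ 1) :
    (relationSet p a b e s).ncard ≤ 2 * (∑ ij ∈ underDiag5, (e ij).natAbs) * p ^ 3 := by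
  obtain ⟨B, hB, rfl, rfl, hne⟩ := h
  have hF : pairPoly (B 0) (B 1) e s ≠ 0 := fun h0 =>
    hne ((eval_pairPoly_eq_zero_iff hB e s).1 (by rw [h0, map_zero]))
  refine le_trans ?_ ((card_zeros_le hF).trans
    (Nat.mul_le_mul_right _ (totalDegree_pairPoly_le _ _ _ _)))
  rw [← Set.ncard_coe_finset]
  refine Set.ncard_le_ncard_of_injOn middleCoords ?_ ?_ (Finset.finite_toSet _)
  · rintro A ⟨hA, h0, h1, hs⟩
    simp only [Finset.coe_filter, Finset.mem_univ, true_and, Set.mem_ofPred_eq]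
    rw [← h0, ← h1]
    exact (eval_pairPoly_eq_zero_iff hA e s).2 hs
  · rintro A ⟨hA, h0, h1, -⟩ A' ⟨hA', h0', h1', -⟩ heq
    exact eq_of_middleCoords_eq hA.2.1 hA'.2.1 (h0.trans h0'.symm) (h1.trans h1'.symm) heq

/-- The exponent vectors on unordered pairs bounded by `M`. -/
noncomputable def expBox (M : ℕ) : Finset (Fin 5 × Fin 5 → ℤ) :=
  Fintype.piFinset fun ij => if ij ∈ underDiag5 then Finset.Icc (-(M : ℤ)) M else {0}

theorem card_expBox (M : ℕ) : (expBox M).card = (2 * M + 1) ^ 10 := by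
  have h : ∀ ij : Fin 5 × Fin 5,
      (if ij ∈ underDiag5 then Finset.Icc (-(M : ℤ)) M else {0}).card =
        if ij ∈ underDiag5 then 2 * M + 1 else 1 := by
    intro ij
    split_ifs
    · rw [Int.card_Icc]; omega
    · rfl
  rw [expBox, Fintype.card_piFinset, Finset.prod_congr rfl fun ij _ => h ij,
    Finset.prod_ite_mem, Finset.univ_inter, Finset.prod_const,
    show underDiag5.card = 10 by decide]

theorem ncard_short_le {a b : Fin 2 → ZMod p} (hab : (gmat p a b).det ≠ 0) (M : ℕ)
    (hM : ∀ m : ℤ, (m : ℝ) ≤ 2 * ((p ^ 2 - 1 : ℕ) : ℝ) ^ (0.01 : ℝ) → m ≤ M) :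
    {A ∈ AOrdShort p | A 0 = a ∧ A 1 = b}.ncard ≤
      (2 * M + 1) ^ 10 * 2 * (2 * M * p ^ 3) := by
  classical
  set I := (expBox M ×ˢ ({1, -1} : Finset (ZMod p))).filter fun es =>
    (relationSet p a b es.1 es.2).ncard ≤ 2 * M * p ^ 3 with hI
  have hsub : {A ∈ AOrdShort p | A 0 = a ∧ A 1 = b} ⊆
      ⋃ es ∈ I, relationSet p a b es.1 es.2 := by
    rintro A ⟨⟨hA, d, hd, hlen, hnt, h1⟩, h0, h1'⟩
    obtain ⟨s, hs, hω⟩ := exists_omegaEval_eq_mul_pairEval (p := p) d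
    have hsum : ∑ ij ∈ underDiag5, (pairExp d ij).natAbs ≤ M := by
      zify
      refine le_trans (le_of_eq ?_) (hM _ hlen)
      exact Finset.sum_congr rfl fun ij hij => by simp [pairExp, hij]
    refine Set.mem_biUnion (x := (pairExp d, s)) ?_ ⟨hA, h0, h1', by rw [← hω A hA, h1]⟩
    refine Finset.mem_coe.2 (Finset.mem_filter.2 ⟨Finset.mem_product.2 ⟨?_, hs⟩, ?_⟩)
    · refine Fintype.mem_piFinset.2 fun ij => ?_
      split_ifs with hij
      · have := (Finset.single_le_sum (f := fun ij => (pairExp d ij).natAbs)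
          (fun _ _ => Nat.zero_le _) hij).trans hsum
        rw [Finset.mem_Icc]
        dsimp only at this ⊢
        omega
      · simp [pairExp, hij]
    · obtain ⟨B, hB, hB0, hB1, hne⟩ := exists_omegaEval_ne_one hd hnt hab
      refine (ncard_relationSet_le ⟨B, hB, hB0, hB1, by rwa [← hω B hB]⟩).trans ?_
      gcongr
  calc {A ∈ AOrdShort p | A 0 = a ∧ A 1 = b}.ncard
      ≤ (⋃ es ∈ I, relationSet p a b es.1 es.2).ncard :=
        Set.ncard_le_ncard hsub (Set.toFinite _)
    _ ≤ ∑ es ∈ I, (relationSet p a b es.1 es.2).ncard := Finset.set_ncard_biUnion_le _ _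
    _ ≤ I.card * (2 * M * p ^ 3) := by
        rw [← smul_eq_mul]
        exact Finset.sum_le_card_nsmul _ _ _ fun es hes => (Finset.mem_filter.1 hes).2
    _ ≤ (2 * M + 1) ^ 10 * 2 * (2 * M * p ^ 3) := by
        refine Nat.mul_le_mul_right _ ((Finset.card_filter_le _ _).trans ?_)
        rw [Finset.card_product, card_expBox]
        exact Nat.mul_le_mul_left _ Finset.card_le_two

end Counting

/-- There is a constant `C` such that for every prime `p` and all linearly independent
`α, β ∈ 𝔽_p² ∖ {0}`, the number of tuples in `𝒜_ord^short` with first two entries `α, β`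
is at most `C · n^{1.7}` (with `n = p² - 1`). -/
theorem stmt11 :
    ∃ C : ℝ, ∀ (p : ℕ) [Fact p.Prime], ∀ α β : Fin 2 → ZMod p,
      α ≠ 0 → β ≠ 0 → LinearIndependent (ZMod p) ![α, β] →
      (({A ∈ AOrdShort p | A 0 = α ∧ A 1 = β}).ncard : ℝ) ≤
        C * ((p ^ 2 - 1 : ℕ) : ℝ) ^ (1.7 : ℝ) := by
  refine ⟨5 ^ 10 * 2 * (4 * 4), fun p _ α β hα _ hαβ => ?_⟩
  have hp2 : 2 ≤ p := (Fact.out : p.Prime).two_le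
  have hn : p ^ 2 ≤ 2 * (p ^ 2 - 1) := by
    have : 2 ^ 2 ≤ p ^ 2 := Nat.pow_le_pow_left hp2 2
    omega
  have hn1 : 1 ≤ p ^ 2 - 1 := by
    have : 2 ^ 2 ≤ p ^ 2 := Nat.pow_le_pow_left hp2 2
    omega
  set n : ℝ := ((p ^ 2 - 1 : ℕ) : ℝ) with hndef
  have hn1' : (1 : ℝ) ≤ n := by rw [hndef]; exact_mod_cast hn1
  have hn0 : 0 ≤ n := zero_le_one.trans hn1'
  have hn' : (p : ℝ) ^ 2 ≤ 2 * n := by rw [hndef]; exact_mod_cast hn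
  set t : ℝ := n ^ (0.01 : ℝ) with ht
  have ht1 : 1 ≤ t := Real.one_le_rpow hn1' (by norm_num)
  have hM : (⌊2 * t⌋₊ : ℝ) ≤ 2 * t := Nat.floor_le (by positivity)
  have hcard := ncard_short_le (det_gmat_ne_zero_of_linearIndependent hα hαβ) ⌊2 * t⌋₊ (by
    intro m hm
    rw [Int.natCast_floor_eq_floor (by positivity)]
    exact Int.le_floor.2 hm)
  have hp3 : (p : ℝ) ^ 3 ≤ 4 * n ^ (1.5 : ℝ) := by
    refine le_of_sq_le_sq ?_ (by positivity)
    have h3 : (n ^ (1.5 : ℝ)) ^ 2 = n ^ 3 := by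
      rw [← Real.rpow_natCast, ← Real.rpow_mul hn0, ← Real.rpow_natCast]
      norm_num
    calc ((p : ℝ) ^ 3) ^ 2 = ((p : ℝ) ^ 2) ^ 3 := by ring
      _ ≤ (2 * n) ^ 3 := by gcongr
      _ = 8 * n ^ 3 := by ring
      _ ≤ 16 * n ^ 3 := by gcongr; norm_num
      _ = (4 * n ^ (1.5 : ℝ)) ^ 2 := by rw [mul_pow, h3]; norm_num
  have ht11 : t ^ 11 * n ^ (1.5 : ℝ) ≤ n ^ (1.7 : ℝ) := by
    rw [ht, ← Real.rpow_natCast, ← Real.rpow_mul hn0, ← Real.rpow_add (by positivity)]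
    exact Real.rpow_le_rpow_of_exponent_le hn1' (by norm_num)
  calc (({A ∈ AOrdShort p | A 0 = α ∧ A 1 = β}).ncard : ℝ)
      ≤ (2 * (⌊2 * t⌋₊ : ℝ) + 1) ^ 10 * 2 * (2 * (⌊2 * t⌋₊ : ℝ) * p ^ 3) := by
        exact_mod_cast hcard
    _ ≤ (5 * t) ^ 10 * 2 * (4 * t * (4 * n ^ (1.5 : ℝ))) := by
        have h5 : 2 * (⌊2 * t⌋₊ : ℝ) + 1 ≤ 5 * t := by linarith
        have h4 : 2 * (⌊2 * t⌋₊ : ℝ) ≤ 4 * t := by linarith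
        gcongr
    _ = 5 ^ 10 * 2 * (4 * 4) * (t ^ 11 * n ^ (1.5 : ℝ)) := by ring
    _ ≤ 5 ^ 10 * 2 * (4 * 4) * n ^ (1.7 : ℝ) := by gcongr
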